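/- Let f be a holomorphic function on an open neighborhood of 0 in ℂ³ with f(0,0,0) = 1. Then there exist an open neighborhood U of 0 in ℂ³ and a holomorphic function ψ₁ : U → ℂ such that the map ψ : (x,y₁,y₂) ↦ (x, ψ₁(x,y₁,y₂), y₂) is a biholomorphism of U onto an open neighborhood of 0, its derivative at 0 is the identity (so ψ is tangent to the identity), and f(ψ(x,y₁,y₂))·(∂ψ₁/∂y₁)(x,y₁,y₂) = 1 for all (x,y₁,y₂) ∈ U; equivalently, det Dψ(p)·f(ψ(p)) = 1 for all p ∈ U. -/

import Mathlib

open Complex Filter Set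

noncomputable section

namespace DRSN

open scoped Topology Interval
open Metric intervalIntegral MeasureTheory

section Cauchy

variable {E F : Type*} [NormedAddCommGroup E] [NormedSpace ℂ E] [NormedAddCommGroup F]
  [NormedSpace ℂ F]

/-- The Fréchet derivative of a holomorphic map on an open set is continuous. -/
theorem continuousOn_fderiv_of_differentiableOn {f : E → F} {U : Set E} (hU : IsOpen U)
    (hf : DifferentiableOn ℂ f U) : ContinuousOn (fderiv ℂ f) U := by
  intro c hc
  refine ContinuousAt.continuousWithinAt ?_
  have hfc : ContinuousAt f c := (hf.differentiableAt (hU.mem_nhds hc)).continuousAt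
  obtain ⟨R, hR, hball⟩ := Metric.eventually_nhds_iff_ball.1
    ((hfc.eventually (ball_mem_nhds (f c) one_pos)).and (hU.mem_nhds hc))
  obtain ⟨r, hr, rfl⟩ : ∃ r : ℝ, 0 < r ∧ R = 3 * r := ⟨R / 3, by positivity, by ring⟩
  have hsub : ∀ x ∈ ball c (2 * r), ball x r ⊆ ball c (3 * r) := fun x hx =>
    ball_subset_ball' (by have := mem_ball.1 hx; linarith)
  have hbound : ∀ x ∈ ball c (2 * r), ‖fderiv ℂ f x‖ ≤ 2 / r := by
    intro x hx
    refine norm_fderiv_le_div_of_mapsTo_ball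
      (hf.mono fun y hy => (hball y (hsub x hx hy)).2) (fun y hy => ?_) hr
    have h1 : dist (f y) (f c) < 1 := (hball y (hsub x hx hy)).1
    have h2 : dist (f x) (f c) < 1 := (hball x (hsub x hx (mem_ball_self hr))).1
    have := dist_triangle_right (f y) (f x) (f c)
    exact mem_closedBall.2 (by linarith)
  have hdiff : ∀ x ∈ ball c (3 * r), DifferentiableAt ℂ f x := fun x hx =>
    hf.differentiableAt (hU.mem_nhds (hball x hx).2)
  have hlip : ∀ x ∈ ball c (2 * r), ∀ y ∈ ball c (2 * r), ‖f y - f x‖ ≤ 2 / r * ‖y - x‖ :=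
    fun x hx y hy => (convex_ball c (2 * r)).norm_image_sub_le_of_norm_fderiv_le (𝕜 := ℂ)
      (fun z hz => hdiff z (ball_subset_ball (by linarith) hz)) hbound hx hy
  have hest : ∀ y ∈ ball c r, ‖fderiv ℂ f y - fderiv ℂ f c‖ ≤ 4 / r / r * ‖y - c‖ := by
    intro y hy
    have hyc : ‖y - c‖ < r := by simpa [dist_eq_norm] using hy
    have hshift : ∀ x ∈ ball c r, x + (y - c) ∈ ball c (2 * r) := by
      intro x hx
      have hxc : ‖x - c‖ < r := by simpa [dist_eq_norm] using hx
      rw [mem_ball, dist_eq_norm, add_sub_right_comm]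
      linarith [norm_add_le (x - c) (y - c)]
    have hd : ∀ x ∈ ball c r, HasFDerivAt (fun x => f (x + (y - c)) - f x)
        (fderiv ℂ f (x + (y - c)) - fderiv ℂ f x) x := by
      intro x hx
      have h1 := (hdiff _ (ball_subset_ball (by linarith) (hshift x hx))).hasFDerivAt
      have h2 := (hdiff x (ball_subset_ball (by linarith) hx)).hasFDerivAt
      exact ((hasFDerivAt_comp_add_right (y - c)).2 h1).sub h2
    have hc' := (hd c (mem_ball_self hr)).fderiv
    rw [add_sub_cancel] at hc'
    rw [← hc', show 4 / r / r * ‖y - c‖ = (4 / r * ‖y - c‖) / r by ring]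
    refine norm_fderiv_le_div_of_mapsTo_ball
      (fun x hx => (hd x hx).differentiableAt.differentiableWithinAt) (fun x hx => ?_) hr
    have key : ∀ z ∈ ball c r, ‖f (z + (y - c)) - f z‖ ≤ 2 / r * ‖y - c‖ := fun z hz => by
      simpa using hlip z (ball_subset_ball (by linarith) hz) _ (hshift z hz)
    rw [mem_closedBall, dist_eq_norm]
    refine (norm_sub_le _ _).trans ?_
    have := key x hx
    have := key c (mem_ball_self hr)
    calc _ ≤ 2 / r * ‖y - c‖ + 2 / r * ‖y - c‖ := by gcongr
      _ = _ := by ring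
  refine tendsto_iff_norm_sub_tendsto_zero.2 (squeeze_zero' (Eventually.of_forall fun _ =>
    norm_nonneg _) (eventually_of_mem (ball_mem_nhds c hr) hest) ?_)
  have : ContinuousAt (fun y => 4 / r / r * ‖y - c‖) c := by fun_prop
  simpa [ContinuousAt] using this

theorem contDiffOn_one_of_differentiableOn {f : E → F} {U : Set E} (hU : IsOpen U)
    (hf : DifferentiableOn ℂ f U) : ContDiffOn ℂ 1 f U := by
  rw [show (1 : WithTop ℕ∞) = 0 + 1 from rfl, contDiffOn_succ_iff_fderiv_of_isOpen hU]
  exact ⟨hf, by simp, contDiffOn_zero.2 (continuousOn_fderiv_of_differentiableOn hU hf)⟩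

end Cauchy

/-- The linear map `(x, y₁, y₂) ↦ (x, s y₁, y₂)`. -/
def scaleMid (s : ℝ) : ℂ × ℂ × ℂ →L[ℂ] ℂ × ℂ × ℂ :=
  ContinuousLinearMap.id ℂ _ + ((s : ℂ) - 1) •
    (ContinuousLinearMap.inr ℂ ℂ (ℂ × ℂ) ∘L ContinuousLinearMap.inl ℂ ℂ ℂ ∘L
      ContinuousLinearMap.fst ℂ ℂ ℂ ∘L ContinuousLinearMap.snd ℂ ℂ (ℂ × ℂ))

@[simp]
theorem scaleMid_apply (s : ℝ) (p : ℂ × ℂ × ℂ) :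
    scaleMid s p = (p.1, (s : ℂ) * p.2.1, p.2.2) := by
  ext <;> simp [scaleMid]
  ring

theorem continuous_scaleMid : Continuous scaleMid := by
  unfold scaleMid
  fun_prop

theorem scaleMid_mem_ball {s r : ℝ} (hs : s ∈ Icc (0 : ℝ) 1) {p : ℂ × ℂ × ℂ}
    (hp : p ∈ ball 0 r) : scaleMid s p ∈ ball 0 r := by
  simp only [mem_ball_zero_iff, Prod.norm_def, scaleMid_apply, max_lt_iff, norm_mul,
    Complex.norm_real, Real.norm_eq_abs, abs_of_nonneg hs.1] at hp ⊢
  exact ⟨hp.1, (mul_le_of_le_one_left (norm_nonneg _) hs.2).trans_lt hp.2.1, hp.2.2⟩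

/-- The primitive `∫₀^{y₁} f(x, t, y₂) dt` of `f` in the variable `y₁`. -/
def midPrimitive (f : ℂ × ℂ × ℂ → ℂ) (p : ℂ × ℂ × ℂ) : ℂ :=
  p.2.1 * ∫ s in (0 : ℝ)..1, f (scaleMid s p)

section Primitive

variable {f : ℂ × ℂ × ℂ → ℂ} {r : ℝ}

theorem continuousOn_fderiv_scaleMid (hf : DifferentiableOn ℂ f (ball 0 r)) {p : ℂ × ℂ × ℂ}
    (hp : p ∈ ball 0 r) :
    ContinuousOn (fun s : ℝ => (fderiv ℂ f (scaleMid s p)).comp (scaleMid s)) (Icc 0 1) := by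
  have h1 : ContinuousOn (fun s : ℝ => fderiv ℂ f (scaleMid s p)) (Icc 0 1) :=
    (continuousOn_fderiv_of_differentiableOn isOpen_ball hf).comp
      (continuous_scaleMid.clm_apply continuous_const).continuousOn
      fun s hs => scaleMid_mem_ball hs hp
  exact h1.clm_comp continuous_scaleMid.continuousOn

theorem hasFDerivAt_integral_scaleMid (hf : DifferentiableOn ℂ f (ball 0 r)) {C : ℝ}
    (hC : ∀ p ∈ ball 0 r, ‖fderiv ℂ f p‖ ≤ C) {p : ℂ × ℂ × ℂ} (hp : p ∈ ball 0 r) :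
    HasFDerivAt (fun p => ∫ s in (0 : ℝ)..1, f (scaleMid s p))
      (∫ s in (0 : ℝ)..1, (fderiv ℂ f (scaleMid s p)).comp (scaleMid s)) p := by
  have hsub : Ι (0 : ℝ) 1 ⊆ Icc 0 1 := by
    rw [uIoc_of_le zero_le_one]; exact Ioc_subset_Icc_self
  have hcont : ∀ q ∈ ball (0 : ℂ × ℂ × ℂ) r,
      ContinuousOn (fun s : ℝ => f (scaleMid s q)) (Icc 0 1) := fun q hq =>
    hf.continuousOn.comp (continuous_scaleMid.clm_apply continuous_const).continuousOn
      fun s hs => scaleMid_mem_ball hs hq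
  refine hasFDerivAt_integral_of_dominated_of_fderiv_le (𝕜 := ℂ)
    (F := fun q s => f (scaleMid s q))
    (F' := fun q s => (fderiv ℂ f (scaleMid s q)).comp (scaleMid s))
    (s := ball 0 r) (bound := fun s => C * ‖scaleMid s‖) (isOpen_ball.mem_nhds hp) ?_ ?_ ?_ ?_ ?_ ?_
  · filter_upwards [isOpen_ball.mem_nhds hp] with q hq
    exact ((hcont q hq).mono hsub).aestronglyMeasurable measurableSet_uIoc
  · exact ContinuousOn.intervalIntegrable (by simpa using hcont p hp)
  · exact ((continuousOn_fderiv_scaleMid hf hp).mono hsub).aestronglyMeasurable measurableSet_uIoc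
  · refine Eventually.of_forall fun s hs q hq => ?_
    refine (ContinuousLinearMap.opNorm_comp_le _ _).trans ?_
    gcongr
    exact hC _ (scaleMid_mem_ball (hsub hs) hq)
  · exact (continuous_const.mul continuous_scaleMid.norm).intervalIntegrable _ _
  · refine Eventually.of_forall fun s hs q hq => ?_
    have := (hf.differentiableAt
      (isOpen_ball.mem_nhds (scaleMid_mem_ball (hsub hs) hq))).hasFDerivAt
    exact this.comp q (scaleMid s).hasFDerivAt

theorem hasFDerivAt_midPrimitive (hf : DifferentiableOn ℂ f (ball 0 r)) {C : ℝ}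
    (hC : ∀ p ∈ ball 0 r, ‖fderiv ℂ f p‖ ≤ C) {p : ℂ × ℂ × ℂ} (hp : p ∈ ball 0 r) :
    HasFDerivAt (midPrimitive f)
      (p.2.1 • (∫ s in (0 : ℝ)..1, (fderiv ℂ f (scaleMid s p)).comp (scaleMid s)) +
        (∫ s in (0 : ℝ)..1, f (scaleMid s p)) •
          (ContinuousLinearMap.fst ℂ ℂ ℂ ∘L ContinuousLinearMap.snd ℂ ℂ (ℂ × ℂ))) p :=
  HasFDerivAt.mul
    (ContinuousLinearMap.fst ℂ ℂ ℂ ∘L ContinuousLinearMap.snd ℂ ℂ (ℂ × ℂ)).hasFDerivAt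
    (hasFDerivAt_integral_scaleMid hf hC hp)

theorem fderiv_midPrimitive_apply (hf : DifferentiableOn ℂ f (ball 0 r)) {C : ℝ}
    (hC : ∀ p ∈ ball 0 r, ‖fderiv ℂ f p‖ ≤ C) {p : ℂ × ℂ × ℂ} (hp : p ∈ ball 0 r) :
    fderiv ℂ (midPrimitive f) p (0, 1, 0) = f p := by
  have hint : IntervalIntegrable (fun s : ℝ => (fderiv ℂ f (scaleMid s p)).comp (scaleMid s))
      volume 0 1 :=
    ContinuousOn.intervalIntegrable (by simpa using continuousOn_fderiv_scaleMid hf hp)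
  have hint' : IntervalIntegrable (fun s : ℝ => f (scaleMid s p)) volume 0 1 := by
    refine ContinuousOn.intervalIntegrable ?_
    rw [uIcc_of_le zero_le_one]
    exact hf.continuousOn.comp (continuous_scaleMid.clm_apply continuous_const).continuousOn
      fun s hs => scaleMid_mem_ball hs hp
  have hint'' : IntervalIntegrable
      (fun s : ℝ => (fderiv ℂ f (scaleMid s p)).comp (scaleMid s) (0, 1, 0)) volume 0 1 := by
    refine ContinuousOn.intervalIntegrable ?_
    rw [uIcc_of_le zero_le_one]
    exact (continuousOn_fderiv_scaleMid hf hp).clm_apply continuousOn_const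
  have hderiv : ∀ s ∈ uIcc (0 : ℝ) 1, HasDerivAt (fun s : ℝ => (s : ℂ) * f (scaleMid s p))
      (p.2.1 * (fderiv ℂ f (scaleMid s p)).comp (scaleMid s) (0, 1, 0) + f (scaleMid s p)) s := by
    intro s hs
    rw [uIcc_of_le zero_le_one] at hs
    have hs' : HasDerivAt (fun s : ℝ => (s : ℂ)) 1 s := Complex.ofRealCLM.hasDerivAt
    have hcurve : HasDerivAt (fun s : ℝ => scaleMid s p) (p.2.1 • (0, 1, 0)) s := by
      simp only [scaleMid_apply]
      simpa using (hasDerivAt_const s p.1).prodMk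
        ((hs'.mul_const p.2.1).prodMk (hasDerivAt_const s p.2.2))
    have hfd := (hf.differentiableAt
      (isOpen_ball.mem_nhds (scaleMid_mem_ball hs hp))).hasFDerivAt.restrictScalars ℝ
    have := hs'.mul (hfd.comp_hasDerivAt s hcurve)
    refine this.congr_deriv ?_
    have h2 : scaleMid s (0, 1, 0) = (s : ℂ) • (0, 1, 0) := by simp
    rw [ContinuousLinearMap.comp_apply, h2]
    simp only [ContinuousLinearMap.coe_restrictScalars', map_smul, smul_eq_mul, Function.comp]
    ring
  have hFTC := integral_eq_sub_of_hasDerivAt hderiv ((hint''.const_mul p.2.1).add hint')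
  rw [intervalIntegral.integral_add (hint''.const_mul p.2.1) hint',
    intervalIntegral.integral_const_mul] at hFTC
  rw [(hasFDerivAt_midPrimitive hf hC hp).fderiv]
  simp only [_root_.add_apply, _root_.smul_apply,
    ContinuousLinearMap.intervalIntegral_apply hint]
  simpa using hFTC

end Primitive


/-- Given `f` holomorphic near `0 ∈ ℂ³` with `f(0) = 1`, there is a
fibered biholomorphism `ψ : (x,y₁,y₂) ↦ (x, ψ₁, y₂)` between neighborhoods of `0`, tangent
to the identity, with `f(ψ)·∂ψ₁/∂y₁ = 1`, i.e. `det Dψ · (f ∘ ψ) = 1`. -/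
theorem symplectic_rectification
    (f : ℂ × ℂ × ℂ → ℂ) (W : Set (ℂ × ℂ × ℂ)) (hW : IsOpen W)
    (h0W : (0 : ℂ × ℂ × ℂ) ∈ W) (hf : DifferentiableOn ℂ f W) (hf0 : f 0 = 1) :
    ∃ (U : Set (ℂ × ℂ × ℂ)) (ψ1 : ℂ × ℂ × ℂ → ℂ),
      IsOpen U ∧ (0 : ℂ × ℂ × ℂ) ∈ U ∧ U ⊆ W ∧
      DifferentiableOn ℂ ψ1 U ∧
      Set.InjOn (fun p : ℂ × ℂ × ℂ => (p.1, ψ1 p, p.2.2)) U ∧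
      IsOpen ((fun p : ℂ × ℂ × ℂ => (p.1, ψ1 p, p.2.2)) '' U) ∧
      (0 : ℂ × ℂ × ℂ) ∈ (fun p : ℂ × ℂ × ℂ => (p.1, ψ1 p, p.2.2)) '' U ∧
      (fun p : ℂ × ℂ × ℂ => (p.1, ψ1 p, p.2.2)) '' U ⊆ W ∧
      fderiv ℂ (fun p : ℂ × ℂ × ℂ => (p.1, ψ1 p, p.2.2)) 0
        = ContinuousLinearMap.id ℂ (ℂ × ℂ × ℂ) ∧
      ∀ p ∈ U, f (p.1, ψ1 p, p.2.2) * fderiv ℂ ψ1 p (0, 1, 0) = 1 := by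
  obtain ⟨R, hR, hRW⟩ := Metric.isOpen_iff.1 hW 0 h0W
  have hcont : ContinuousAt (fderiv ℂ f) 0 :=
    (continuousOn_fderiv_of_differentiableOn hW hf).continuousAt (hW.mem_nhds h0W)
  obtain ⟨δ, hδ, hδC⟩ := Metric.eventually_nhds_iff_ball.1
    (hcont.norm.eventually (gt_mem_nhds (lt_add_one _)))
  set r := min R δ
  have hr : 0 < r := lt_min hR hδ
  have hrW : ball 0 r ⊆ W := (ball_subset_ball (min_le_left _ _)).trans hRW
  have hfr : DifferentiableOn ℂ f (ball 0 r) := hf.mono hrW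
  have hC : ∀ p ∈ ball 0 r, ‖fderiv ℂ f p‖ ≤ ‖fderiv ℂ f 0‖ + 1 := fun p hp =>
    (hδC p (ball_subset_ball (min_le_right _ _) hp)).le
  have h0r : (0 : ℂ × ℂ × ℂ) ∈ ball 0 r := mem_ball_self hr
  have hHd : DifferentiableOn ℂ (midPrimitive f) (ball 0 r) := fun p hp =>
    (hasFDerivAt_midPrimitive hfr hC hp).differentiableAt.differentiableWithinAt
  let Φ : ℂ × ℂ × ℂ → ℂ × ℂ × ℂ := fun p => (p.1, midPrimitive f p, p.2.2)
  have hΦ0 : Φ 0 = 0 := by simp [Φ, midPrimitive]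
  have hΦd : DifferentiableOn ℂ Φ (ball 0 r) :=
    differentiableOn_fst.prodMk (hHd.prodMk (differentiable_snd.snd.differentiableOn))
  have hΦC : ContDiffAt ℂ 1 Φ 0 :=
    (contDiffOn_one_of_differentiableOn isOpen_ball hΦd).contDiffAt (isOpen_ball.mem_nhds h0r)
  have hΦ' : HasFDerivAt Φ
      (ContinuousLinearEquiv.refl ℂ (ℂ × ℂ × ℂ) : ℂ × ℂ × ℂ →L[ℂ] ℂ × ℂ × ℂ) 0 := by
    have h := hasFDerivAt_fst.prodMk
      ((hasFDerivAt_midPrimitive hfr hC h0r).prodMk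
        (hasFDerivAt_snd (𝕜 := ℂ) (p := (0 : ℂ × ℂ × ℂ))).snd)
    refine h.congr_fderiv ?_
    have hf0' : f (0, 0, 0) = 1 := hf0
    ext <;> simp [hf0']
  let e := hΦC.toOpenPartialHomeomorph Φ hΦ' one_ne_zero
  have h0t : (0 : ℂ × ℂ × ℂ) ∈ e.target := by
    have := hΦC.image_mem_toOpenPartialHomeomorph_target hΦ' one_ne_zero
    rwa [hΦ0] at this
  have he0 : e.symm 0 = 0 := by
    have := hΦC.localInverse_apply_image hΦ' one_ne_zero
    rwa [hΦ0] at this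
  have hsymmC : ContDiffAt ℂ 1 e.symm 0 := by
    have := hΦC.to_localInverse hΦ' one_ne_zero
    rwa [hΦ0] at this
  have hsymm' : HasFDerivAt e.symm (ContinuousLinearMap.id ℂ (ℂ × ℂ × ℂ)) 0 := by
    have := (hΦC.hasStrictFDerivAt' hΦ' one_ne_zero).to_localInverse.hasFDerivAt
    rwa [hΦ0] at this
  have hev : ∀ᶠ p in 𝓝 (0 : ℂ × ℂ × ℂ),
      p ∈ e.target ∧ p ∈ W ∧ e.symm p ∈ ball 0 r ∧ DifferentiableAt ℂ e.symm p := by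
    refine Eventually.and (e.open_target.mem_nhds h0t)
      (Eventually.and (hW.mem_nhds h0W) (Eventually.and ?_ ?_))
    · exact hsymmC.continuousAt.eventually (by rw [he0]; exact isOpen_ball.mem_nhds h0r)
    · exact (hsymmC.eventually (by simp)).mono fun p hp => hp.differentiableAt one_ne_zero
  obtain ⟨U, hU, hUo, h0U⟩ := _root_.eventually_nhds_iff.1 hev
  have hright : ∀ p ∈ U, Φ (e.symm p) = p := fun p hp => e.right_inv (hU p hp).1
  have hψ : EqOn (fun p : ℂ × ℂ × ℂ => (p.1, (e.symm p).2.1, p.2.2)) e.symm U := by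
    intro p hp
    have h := hright p hp
    have h1 : (e.symm p).1 = p.1 := (Prod.ext_iff.1 h).1
    have h2 : (e.symm p).2.2 = p.2.2 := (Prod.ext_iff.1 (Prod.ext_iff.1 h).2).2
    ext <;> simp [h1, h2]
  have hUt : U ⊆ e.target := fun p hp => (hU p hp).1
  refine ⟨U, fun p => (e.symm p).2.1, hUo, h0U, fun p hp => (hU p hp).2.1,
    fun p hp => (hU p hp).2.2.2.snd.fst.differentiableWithinAt,
    hψ.injOn_iff.2 (e.symm.injOn.mono hUt), ?_, ?_, ?_, ?_, ?_⟩
  · rw [hψ.image_eq]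
    exact e.symm.isOpen_image_of_subset_source hUo hUt
  · exact ⟨0, h0U, (hψ h0U).trans he0⟩
  · rw [hψ.image_eq]
    rintro _ ⟨p, hp, rfl⟩
    exact hrW (hU p hp).2.2.1
  · exact (hψ.eventuallyEq_of_mem (hUo.mem_nhds h0U)).fderiv_eq.trans hsymm'.fderiv
  · intro p hp
    have hd := (hU p hp).2.2.2.hasFDerivAt
    have hq := (hU p hp).2.2.1
    have hψ1 : HasFDerivAt (fun p => (e.symm p).2.1) _ p := hd.snd.fst
    have heq := hψ.eventuallyEq_of_mem (hUo.mem_nhds hp)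
    have hψd := (hasFDerivAt_fst.prodMk (hψ1.differentiableAt.hasFDerivAt.prodMk
      (hasFDerivAt_snd (𝕜 := ℂ) (p := p)).snd)).congr_of_eventuallyEq heq.symm
    have hcomp := ((hHd.differentiableAt (isOpen_ball.mem_nhds hq)).hasFDerivAt.comp p hψd)
    have hmid : midPrimitive f ∘ e.symm =ᶠ[𝓝 p] fun q => q.2.1 := by
      filter_upwards [hUo.mem_nhds hp] with q hq
      exact congrArg (fun q : ℂ × ℂ × ℂ => q.2.1) (hright q hq)
    have huniq := (hcomp.congr_of_eventuallyEq hmid.symm).unique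
      (hasFDerivAt_snd (𝕜 := ℂ) (p := p)).fst
    have h1 := DFunLike.congr_fun huniq (0, 1, 0)
    have hp' : (p.1, (e.symm p).2.1, p.2.2) = e.symm p := hψ hp
    set a := fderiv ℂ (fun p => (e.symm p).2.1) p (0, 1, 0) with ha
    have hv : ((0, a, 0) : ℂ × ℂ × ℂ) = a • (0, 1, 0) := by simp
    simp only [ContinuousLinearMap.comp_apply, ContinuousLinearMap.prod_apply,
      ContinuousLinearMap.coe_fst', ContinuousLinearMap.coe_snd', ← ha] at h1
    rw [hv, map_smul, fderiv_midPrimitive_apply hfr hC hq, smul_eq_mul] at h1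
    change f (p.1, (e.symm p).2.1, p.2.2) * a = 1
    rw [hp', mul_comm]
    exact h1

end DRSN
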